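/- arXiv:2603.14735 — 2 statements merged into one kernel-verified Lean document; each statement's English description precedes it below -/
import Mathlib

section
/- Let (L, ∘_λ, [·_λ·]) be a transposed Poisson conformal algebra. Then for all x, y, u, v ∈ L the identity [(u∘_λ x)_μ (v∘_γ y)] + [(v∘_γ x)_{γ+μ−λ} (u∘_λ y)] = 2(u∘_λ v)∘_{λ+γ}[x_{μ−λ} y] holds (as an identity of polynomials in λ, μ, γ with coefficients in L, where substitutions of the λ-variable by expressions involving ∂ are interpreted via the ℂ[∂]-module action). -/
/-!
We model a `ℂ[∂]`-module as a complex vector space `L` together with an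
endomorphism `D` (the action of `∂`).  A `λ`-product (or `λ`-bracket) is a
`ℂ`-bilinear map `L → L → L[λ]`, where the polynomial `x ∘_λ y = Σₙ λⁿ • cₙ`
is encoded by its finitely supported family of coefficients `ℕ →₀ L`.
Substitution of the variable `λ` by a complex scalar, or by an operator such
as `-∂-λ`, is given by `ev`; since `ℂ` is infinite, an identity of
polynomials in (several) variables `λ, μ, γ` with coefficients in a complex
vector space holds formally if and only if it holds for all complex values
of the variables, which is how all identities are stated below.
-/

namespace ConfFormal

variable {L : Type*} [AddCommGroup L] [Module ℂ L]

/-- Evaluation of a polynomial `p = Σₙ λⁿ • pₙ` with coefficients in `L`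
(encoded as the family of its coefficients) at an endomorphism `T` of `L`
(for instance at a scalar `λ`, or at an operator such as `-∂-λ`). -/
noncomputable def ev (T : Module.End ℂ L) (p : ℕ →₀ L) : L :=
  p.sum fun n x => (T ^ n) x

/-- `app m T x y` is `x ∘_T y` : the `λ`-product `x ∘_λ y` recorded by the
`ℂ`-bilinear coefficient map `m`, with the variable `λ` substituted by the
endomorphism `T`. -/
noncomputable def app (m : L →ₗ[ℂ] L →ₗ[ℂ] (ℕ →₀ L)) (T : Module.End ℂ L) (x y : L) : L :=
  ev T (m x y)

/-- The scalar `c` viewed as an endomorphism of `L`. -/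
noncomputable def sc (c : ℂ) : Module.End ℂ L := c • (1 : Module.End ℂ L)

/-- `(L, D, m)` is a conformal algebra: conformal sesquilinearity holds. -/
structure IsConfAlg (D : Module.End ℂ L) (m : L →ₗ[ℂ] L →ₗ[ℂ] (ℕ →₀ L)) : Prop where
  sesq_left : ∀ (x y : L) (l : ℂ), app m (sc l) (D x) y = -l • app m (sc l) x y
  sesq_right : ∀ (x y : L) (l : ℂ),
    app m (sc l) x (D y) = D (app m (sc l) x y) + l • app m (sc l) x y

/-- `(L, D, m)` is a commutative associative conformal algebra. -/
structure IsCommAssocConfAlg (D : Module.End ℂ L) (m : L →ₗ[ℂ] L →ₗ[ℂ] (ℕ →₀ L))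
    extends IsConfAlg D m : Prop where
  assoc : ∀ (x y z : L) (l u : ℂ),
    app m (sc l) x (app m (sc u) y z) = app m (sc (l + u)) (app m (sc l) x y) z
  comm : ∀ (x y : L) (l : ℂ), app m (sc l) x y = app m (-(D + sc l)) y x

/-- `(L, D, br)` is a Lie conformal algebra. -/
structure IsLieConfAlg (D : Module.End ℂ L) (br : L →ₗ[ℂ] L →ₗ[ℂ] (ℕ →₀ L)) : Prop where
  sesq_left : ∀ (x y : L) (l : ℂ), app br (sc l) (D x) y = -l • app br (sc l) x y
  skew : ∀ (x y : L) (l : ℂ), app br (sc l) x y = -app br (-(sc l + D)) y x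
  jacobi : ∀ (x y z : L) (l u : ℂ),
    app br (sc l) x (app br (sc u) y z) =
      app br (sc (l + u)) (app br (sc l) x y) z + app br (sc u) y (app br (sc l) x z)

/-- `(L, D, m, br)` is a transposed Poisson conformal algebra. -/
structure IsTPCA (D : Module.End ℂ L) (m br : L →ₗ[ℂ] L →ₗ[ℂ] (ℕ →₀ L)) : Prop where
  commAssoc : IsCommAssocConfAlg D m
  lie : IsLieConfAlg D br
  tLeibniz : ∀ (x y z : L) (l u : ℂ),
    (2 : ℂ) • app m (sc l) x (app br (sc u) y z) =
      app br (sc (l + u)) (app m (sc l) x y) z + app br (sc u) y (app m (sc l) x z)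


theorem ev_add {L : Type*} [AddCommGroup L] [Module ℂ L] (T : Module.End ℂ L) (p q : ℕ →₀ L) :
    ev T (p + q) = ev T p + ev T q :=
  Finsupp.sum_add_index' (fun _ => map_zero _) fun _ _ _ => map_add _ _ _

theorem app_add_right {L : Type*} [AddCommGroup L] [Module ℂ L]
    (m : L →ₗ[ℂ] L →ₗ[ℂ] (ℕ →₀ L)) (T : Module.End ℂ L) (x y z : L) :
    app m T x (y + z) = app m T x y + app m T x z := by
  simp only [app, map_add, ev_add]

/-- In a transposed Poisson conformal algebra,
`[(u∘_λ x)_μ (v∘_γ y)] + [(v∘_γ x)_{γ+μ−λ} (u∘_λ y)] = 2(u∘_λ v)∘_{λ+γ}[x_{μ−λ} y]`. -/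
theorem tpca_identity_ss1 {L : Type*} [AddCommGroup L] [Module ℂ L]
    (D : Module.End ℂ L) (m br : L →ₗ[ℂ] L →ₗ[ℂ] (ℕ →₀ L))
    (hT : IsTPCA D m br) :
    ∀ (x y u v : L) (l mu g : ℂ),
      app br (sc mu) (app m (sc l) u x) (app m (sc g) v y)
        + app br (sc (g + mu - l)) (app m (sc g) v x) (app m (sc l) u y)
      = (2 : ℂ) • app m (sc (l + g)) (app m (sc l) u v) (app br (sc (mu - l)) x y) := by
  intro x y u v l mu g
  have hassoc := hT.commAssoc.assoc
  have hinner := hT.tLeibniz v x y g (mu - l)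
  have houter₁ := hT.tLeibniz u (app m (sc g) v x) y l (g + (mu - l))
  have houter₂ := hT.tLeibniz u x (app m (sc g) v y) l (mu - l)
  have hprod := hT.tLeibniz (app m (sc l) u v) x y (l + g) (mu - l)
  rw [← hassoc, ← hassoc, ← hassoc] at hprod
  rw [← hassoc]
  have happ := congrArg (app m (sc l) u) hinner
  rw [two_smul, app_add_right, app_add_right] at happ
  rw [show l + (g + (mu - l)) = g + mu by ring, show g + (mu - l) = g + mu - l by ring]
    at houter₁
  rw [show l + (mu - l) = mu by ring] at houter₂
  rw [show l + g + (mu - l) = g + mu by ring] at hprod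
  rw [show g + (mu - l) = g + mu - l by ring] at happ
  linear_combination (norm := module) hprod - houter₁ - houter₂ - (2 : ℂ) • happ

end ConfFormal
end

section
/- Let (L, ∘_λ, [·_λ·]) be a transposed Poisson conformal algebra. For h ∈ L define a new λ-bracket on L by [x_λ y]^h = h∘_{(0)}[x_λ y], where h∘_{(0)} z denotes the evaluation at μ = 0 of the polynomial h∘_μ z, applied coefficientwise to the polynomial [x_λ y] ∈ L[λ]. Then (L, ∘_λ, [·_λ·]^h) is a transposed Poisson conformal algebra. -/
/-!
We model a `ℂ[∂]`-module as a complex vector space `L` together with an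
endomorphism `D` (the action of `∂`).  A `λ`-product (or `λ`-bracket) is a
`ℂ`-bilinear map `L → L → L[λ]`, where the polynomial `x ∘_λ y = Σₙ λⁿ • cₙ`
is encoded by its finitely supported family of coefficients `ℕ →₀ L`.
Substitution of the variable `λ` by a complex scalar, or by an operator such
as `-∂-λ`, is given by `ev`; since `ℂ` is infinite, an identity of
polynomials in (several) variables `λ, μ, γ` with coefficients in a complex
vector space holds formally if and only if it holds for all complex values
of the variables, which is how all identities are stated below.
-/

namespace ConfFormal

variable {L : Type*} [AddCommGroup L] [Module ℂ L]

/-- `app m T` as a bilinear map. -/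
noncomputable def appHom (m : L →ₗ[ℂ] L →ₗ[ℂ] (ℕ →₀ L)) (T : Module.End ℂ L) :
    L →ₗ[ℂ] L →ₗ[ℂ] L :=
  m.compr₂ (Finsupp.lsum ℂ fun n => T ^ n)

lemma app_eq_appHom (m : L →ₗ[ℂ] L →ₗ[ℂ] (ℕ →₀ L)) (T : Module.End ℂ L) (x y : L) :
    app m T x y = appHom m T x y := rfl

lemma sc_pow_apply (l : ℂ) (n : ℕ) (x : L) : (sc l ^ n) x = l ^ n • x := by
  simp [sc, smul_pow]

/-- A polynomial with coefficients in `L` that vanishes at every scalar is zero. -/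
lemma eq_zero_of_ev_sc_eq_zero {p : ℕ →₀ L} (hp : ∀ l : ℂ, ev (sc l) p = 0) : p = 0 := by
  ext n
  rw [Finsupp.zero_apply, ← Module.forall_dual_apply_eq_zero_iff ℂ]
  intro f
  have hq : (∑ k ∈ p.support, Polynomial.monomial k (f (p k))) = 0 := by
    refine Polynomial.funext fun l => ?_
    have := congrArg f (hp l)
    simp only [ev, Finsupp.sum, sc_pow_apply, map_sum, map_smul, map_zero, smul_eq_mul] at this
    simpa [Polynomial.eval_finsetSum, mul_comm] using this
  have hn := congrArg (Polynomial.coeff · n) hq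
  simp only [Polynomial.finsetSum_coeff, Polynomial.coeff_monomial, Polynomial.coeff_zero,
    Finset.sum_ite_eq', Finsupp.mem_support_iff] at hn
  by_cases h0 : p n = 0
  · simp [h0]
  · simpa [h0] using hn

lemma ev_mapRange {M T : Module.End ℂ L} (hMT : Commute M T) (p : ℕ →₀ L) :
    ev T (Finsupp.mapRange.linearMap M p) = M (ev T p) := by
  simp only [ev, Finsupp.mapRange.linearMap_apply]
  rw [Finsupp.sum_mapRange_index (by simp), Finsupp.sum, Finsupp.sum, map_sum]
  exact Finset.sum_congr rfl fun n _ => (DFunLike.congr_fun (hMT.pow_right n).eq (p n)).symm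

lemma commute_sc (M : Module.End ℂ L) (l : ℂ) : Commute M (sc l) :=
  (Commute.one_right M).smul_right l

/-- If two products are related by `M` at every scalar value of `λ`, then so they are at every
operator commuting with `M`. -/
lemma app_eq_of_forall_sc {m m' : L →ₗ[ℂ] L →ₗ[ℂ] (ℕ →₀ L)} {M T : Module.End ℂ L}
    (hm : ∀ (x y : L) (l : ℂ), app m' (sc l) x y = M (app m (sc l) x y))
    (hMT : Commute M T) (x y : L) : app m' T x y = M (app m T x y) := by
  have hp : m' x y = Finsupp.mapRange.linearMap M (m x y) := by
    rw [← sub_eq_zero]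
    refine eq_zero_of_ev_sc_eq_zero fun l => ?_
    have hsub : ∀ p q : ℕ →₀ L, ev (sc l) (p - q) = ev (sc l) p - ev (sc l) q :=
      map_sub (Finsupp.lsum ℂ fun n => (sc l : Module.End ℂ L) ^ n)
    rw [hsub, ev_mapRange (commute_sc M l), sub_eq_zero]
    exact hm x y l
  rw [app, hp, ev_mapRange hMT, app]

lemma IsConfAlg.appHom_pow_left {D : Module.End ℂ L} {m : L →ₗ[ℂ] L →ₗ[ℂ] (ℕ →₀ L)}
    (hm : IsConfAlg D m) (l : ℂ) (n : ℕ) (x y : L) :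
    appHom m (sc l) (((-D) ^ n) x) y = l ^ n • appHom m (sc l) x y := by
  induction n generalizing x with
  | zero => simp
  | succ n ih =>
    have h1 := hm.sesq_left x y l
    simp only [app_eq_appHom] at h1
    rw [pow_succ, Module.End.mul_apply, ih, LinearMap.neg_apply, map_neg, LinearMap.neg_apply,
      h1, neg_smul, neg_neg, smul_smul, ← pow_succ]

/-- The operators `x ∘_λ` and `h ∘_{(0)}` commute. -/
lemma IsCommAssocConfAlg.left_comm_zero {D : Module.End ℂ L}
    {m : L →ₗ[ℂ] L →ₗ[ℂ] (ℕ →₀ L)} (hm : IsCommAssocConfAlg D m) (x h w : L) (l : ℂ) :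
    app m (sc l) x (app m (sc 0) h w) = app m (sc 0) h (app m (sc l) x w) := by
  rw [hm.assoc, hm.assoc, hm.comm h x 0, add_zero, zero_add]
  have h0 : -(D + sc 0) = -D := by simp [sc]
  have hsum : ∀ T : Module.End ℂ L, app m T x h = ∑ n ∈ (m x h).support, (T ^ n) (m x h n) :=
    fun _ => rfl
  rw [h0, hsum, hsum, app_eq_appHom, app_eq_appHom]
  simp only [map_sum, LinearMap.sum_apply, sc_pow_apply, map_smul, LinearMap.smul_apply,
    hm.toIsConfAlg.appHom_pow_left]

/-- Composing a Lie conformal bracket with a half-derivation yields the Jacobi identity. -/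
lemma IsLieConfAlg.jacobi_of_half_derivation {D : Module.End ℂ L}
    {br : L →ₗ[ℂ] L →ₗ[ℂ] (ℕ →₀ L)} (hL : IsLieConfAlg D br) {M : Module.End ℂ L}
    (hM : ∀ (x y : L) (l : ℂ), (2 : ℂ) • M (app br (sc l) x y) =
      app br (sc l) (M x) y + app br (sc l) x (M y)) (x y z : L) (l u : ℂ) :
    app br (sc l) x (M (app br (sc u) y z)) =
      app br (sc (l + u)) (M (app br (sc l) x y)) z +
        app br (sc u) y (M (app br (sc l) x z)) := by
  have hJ := congrArg ((2 : ℂ) • M ·) (hL.jacobi x y z l u)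
  simp only [map_add, smul_add, hM] at hJ
  have hx := hL.jacobi (M x) y z l u
  have hy := hL.jacobi x (M y) z l u
  have hz := hL.jacobi x y (M z) l u
  have h1 := congrArg (appHom br (sc l) x) (hM y z u)
  have h2 := congrArg (appHom br (sc (l + u)) · z) (hM x y l)
  have h3 := congrArg (appHom br (sc u) y) (hM x z l)
  simp only [map_add, map_smul, LinearMap.add_apply, LinearMap.smul_apply,
    ← app_eq_appHom] at h1 h2 h3
  linear_combination (norm := module) h1 - h2 - h3 + hx + hy + hz - hJ

/-- If `(L, ∘_λ, [·_λ·])` is a transposed Poisson conformal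
algebra and `h ∈ L`, then the new bracket `[x_λ y]^h = h ∘_{(0)} [x_λ y]`
(where `h ∘_{(0)} z` is the evaluation at `μ = 0` of `h ∘_μ z`, applied
coefficientwise to the polynomial `[x_λ y]`) again makes `(L, ∘_λ, [·_λ·]^h)`
a transposed Poisson conformal algebra. -/
theorem tpca_zeroProduct_bracket {L : Type*} [AddCommGroup L] [Module ℂ L]
    (D : Module.End ℂ L) (m br : L →ₗ[ℂ] L →ₗ[ℂ] (ℕ →₀ L))
    (hT : IsTPCA D m br) (h : L)
    (br' : L →ₗ[ℂ] L →ₗ[ℂ] (ℕ →₀ L))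
    (hbr' : ∀ (x y : L) (l : ℂ),
      app br' (sc l) x y = app m (sc 0) h (app br (sc l) x y)) :
    IsTPCA D m br' := by
  have hmul := hT.commAssoc
  have hD : Commute (appHom m (sc 0) h) D := by
    refine LinearMap.ext fun x => ?_
    have := hmul.sesq_right h x 0
    simpa [app_eq_appHom] using this
  have happ : ∀ (T : Module.End ℂ L), Commute (appHom m (sc 0) h) T → ∀ x y : L,
      app br' T x y = app m (sc 0) h (app br T x y) :=
    fun T hc => app_eq_of_forall_sc hbr' hc
  have hhalf : ∀ (x y : L) (l : ℂ), (2 : ℂ) • appHom m (sc 0) h (app br (sc l) x y) =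
      app br (sc l) (appHom m (sc 0) h x) y + app br (sc l) x (appHom m (sc 0) h y) := by
    intro x y l
    simpa [app_eq_appHom] using hT.tLeibniz h x y 0 l
  refine ⟨hmul, ⟨fun x y l => ?_, fun x y l => ?_, fun x y z l u => ?_⟩, fun x y z l u => ?_⟩
  · rw [hbr', hbr', hT.lie.sesq_left, app_eq_appHom m, app_eq_appHom m, map_smul]
  · rw [hbr', happ _ ((commute_sc _ l).add_right hD).neg_right, hT.lie.skew, app_eq_appHom,
      app_eq_appHom m, map_neg]
  · have hj := hT.lie.jacobi_of_half_derivation hhalf x y z l u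
    simp only [hbr', app_eq_appHom m] at hj ⊢
    rw [hj, map_add]
  · simp only [hbr']
    rw [hmul.left_comm_zero, app_eq_appHom m (sc 0), app_eq_appHom m (sc 0),
      app_eq_appHom m (sc 0), ← map_smul, hT.tLeibniz, map_add]

end ConfFormal
end
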